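/- Let c ∈ 𝕋 with c ≠ 0 and let t < 0. Then the limit lim_{m→∞} P̄_top(tψ^c | X^c_m) exists in ℝ ∪ {+∞} and equals both P̄_top(tψ^c) and P̲_top(tψ^c); in particular the unrestricted topological pressure P_top(tψ^c) exists as a limit (possibly equal to +∞). -/

import Mathlib

open MeasureTheory Filter Topology Set
open scoped ENNReal

noncomputable section

namespace GTM

abbrev Torus := AddCircle (1 : ℝ)

instance : Fact ((0:ℝ) < 1) := ⟨one_pos⟩

/-- The doubling map on the torus. -/
def dbl (x : Torus) : Torus := x + x

/-- The function `x ↦ |cos (π x)|` lifted to the torus. -/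
def absCos : Torus → ℝ :=
  Function.Periodic.lift (f := fun x : ℝ => |Real.cos (Real.pi * x)|)
    (by
      intro x
      simp [mul_add, mul_one, Real.cos_add_pi, abs_neg])

/-- The potential `ψ^c(x) = 2 log |cos (π (x - c))|`, with value `⊥ = -∞` at the
singularity `c + 1/2`. -/
def psi (c : Torus) (x : Torus) : EReal :=
  if absCos (x - c) = 0 then ⊥ else ((2 * Real.log (absCos (x - c)) : ℝ) : EReal)

/-- The Birkhoff sums `ψ^c_n` of the potential `ψ^c` under the doubling map. -/
def psiSum (c : Torus) (n : ℕ) (x : Torus) : EReal :=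
  ∑ k ∈ Finset.range n, psi c (dbl^[k] x)

/-- The left endpoint of the dyadic cylinder interval of a binary word. -/
def wordVal (n : ℕ) (ω : Fin n → Bool) : ℝ :=
  ∑ i : Fin n, (if ω i then (1 : ℝ) else 0) / 2 ^ ((i : ℕ) + 1)

/-- The closed dyadic interval `⟨ω⟩ ⊆ 𝕋` associated to a binary word `ω`. -/
def cyl (n : ℕ) (ω : Fin n → Bool) : Set Torus :=
  (fun x : ℝ => (x : Torus)) '' Set.Icc (wordVal n ω) (wordVal n ω + 1 / 2 ^ n)

/-- The exponential function on extended reals, `exp ⊥ = 0`, `exp ⊤ = ∞`. -/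
def eexp (x : EReal) : ℝ≥0∞ :=
  if x = ⊥ then 0 else if x = ⊤ then ⊤ else ENNReal.ofReal (Real.exp x.toReal)

/-- The logarithm on `ℝ≥0∞`, `log 0 = ⊥`, `log ∞ = ⊤`. -/
def elog (x : ℝ≥0∞) : EReal :=
  if x = 0 then ⊥ else if x = ⊤ then ⊤ else ((Real.log x.toReal : ℝ) : EReal)

/-- The partition function `Σ_{ω ∈ {0,1}ⁿ} exp (t · sup_{x ∈ ⟨ω⟩} ψ^c_n(x))`. -/
def presZ (c : Torus) (t : ℝ) (n : ℕ) : ℝ≥0∞ :=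
  ∑ ω : Fin n → Bool, eexp ((t : EReal) * ⨆ x ∈ cyl n ω, psiSum c n x)

/-- The upper topological pressure `P̄_top(t ψ^c)`. -/
def presUpper (c : Torus) (t : ℝ) : EReal :=
  atTop.limsup fun n : ℕ => (((n : ℝ)⁻¹ : ℝ) : EReal) * elog (presZ c t n)

/-- The lower topological pressure `P̲_top(t ψ^c)`. -/
def presLower (c : Torus) (t : ℝ) : EReal :=
  atTop.liminf fun n : ℕ => (((n : ℝ)⁻¹ : ℝ) : EReal) * elog (presZ c t n)

/-- The point of the torus with binary digit sequence `x` (digits `x 0 = x₁, x 1 = x₂, …`). -/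
def toTorus (x : ℕ → Bool) : Torus :=
  ((∑' i : ℕ, (if x i then (1 : ℝ) else 0) / 2 ^ (i + 1) : ℝ) : Torus)

/-- `b` is a binary expansion of the point `y ∈ 𝕋`. -/
def IsBinExp (y : Torus) (b : ℕ → Bool) : Prop := toTorus b = y

/-- The singularity position `c̆ = c + 1/2`. -/
def breve (c : Torus) : Torus := c + (((1 : ℝ) / 2 : ℝ) : Torus)

/-- The subshift `X^c_m` of all binary sequences avoiding the words consisting of the
first `m+1` digits of (any) binary expansion of `c̆`. -/
def Xcm (c : Torus) (m : ℕ) : Set (ℕ → Bool) :=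
  {x | ∀ ℓ : ℕ, ∀ b : ℕ → Bool, IsBinExp (breve c) b → ∃ i : Fin (m + 1), x (ℓ + i) ≠ b i}

open Classical in
/-- The partition function of the pressure restricted to `X^c_m`: the sum runs over the
words `ω ∈ Σ'ⁿ_m` whose cylinder meets `X^c_m`, with `sup` of `ψ^c_n` over the points of
`X^c_m` starting with `ω`. -/
def presZRes (c : Torus) (m : ℕ) (t : ℝ) (n : ℕ) : ℝ≥0∞ :=
  ∑ ω : Fin n → Bool,
    if ∃ x ∈ Xcm c m, ∀ i : Fin n, x i = ω i then
      eexp ((t : EReal) *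
        ⨆ x ∈ {x ∈ Xcm c m | ∀ i : Fin n, x i = ω i}, psiSum c n (toTorus x))
    else 0

/-- The restricted upper topological pressure `P̄_top(t ψ^c | X^c_m)`. -/
def presResUpper (c : Torus) (m : ℕ) (t : ℝ) : EReal :=
  atTop.limsup fun n : ℕ => (((n : ℝ)⁻¹ : ℝ) : EReal) * elog (presZRes c m t n)

theorem eexp_eq_exp (x : EReal) : eexp x = EReal.exp x := by
  induction x <;> simp [eexp]

theorem elog_eq_log (x : ℝ≥0∞) : elog x = ENNReal.log x := by
  simp only [elog, ENNReal.log]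

theorem absCos_coe (x : ℝ) : absCos (x : Torus) = |Real.cos (Real.pi * x)| := rfl

theorem absCos_nonneg (x : Torus) : 0 ≤ absCos x := by
  induction x using QuotientAddGroup.induction_on with
  | H x => exact abs_nonneg _

theorem absCos_le_one (x : Torus) : absCos x ≤ 1 := by
  induction x using QuotientAddGroup.induction_on with
  | H x => exact Real.abs_cos_le_one _

theorem absCos_coe_sub_le (a b : ℝ) (c : Torus) :
    absCos ((a : Torus) - c) ≤ absCos ((b : Torus) - c) + Real.pi * |a - b| := by
  induction c using QuotientAddGroup.induction_on with
  | H c =>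
    change |Real.cos (Real.pi * (a - c))| ≤ |Real.cos (Real.pi * (b - c))| + _
    have h1 := abs_sub_abs_le_abs_sub (Real.cos (Real.pi * (a - c))) (Real.cos (Real.pi * (b - c)))
    have h2 : |Real.cos (Real.pi * (a - c)) - Real.cos (Real.pi * (b - c))| ≤
        |Real.pi * (a - c) - Real.pi * (b - c)| := by
      have := Real.lipschitzWith_cos.dist_le_mul (Real.pi * (a - c)) (Real.pi * (b - c))
      simpa [Real.dist_eq] using this
    have h3 : |Real.pi * (a - c) - Real.pi * (b - c)| = Real.pi * |a - b| := by
      rw [← mul_sub, abs_mul, abs_of_pos Real.pi_pos]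
      congr 2
      ring
    linarith

theorem continuous_absCos : Continuous absCos :=
  continuous_coinduced_dom.mpr (by
    change Continuous fun x : ℝ => |Real.cos (Real.pi * x)|
    fun_prop)

theorem eq_breve_of_absCos_sub_eq_zero {c x : Torus} (h : absCos (x - c) = 0) : x = breve c := by
  obtain ⟨y, hy⟩ := QuotientAddGroup.mk_surjective (x - c)
  have hy' : x - c = (y : Torus) := hy.symm
  rw [hy', absCos_coe, abs_eq_zero, Real.cos_eq_zero_iff] at h
  obtain ⟨k, hk⟩ := h
  have hyk : y = k + 1 / 2 := by
    have : Real.pi * y = Real.pi * (k + 1 / 2) := by rw [hk]; ring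
    exact mul_left_cancel₀ Real.pi_ne_zero this
  have hkz : ((k : ℝ) : Torus) = 0 := by
    rw [AddCircle.coe_eq_zero_iff]
    exact ⟨k, by simp⟩
  rw [sub_eq_iff_eq_add] at hy'
  rw [hy', hyk, AddCircle.coe_add, hkz, zero_add, add_comm]
  rfl

/-- The weight `exp (t ψ^c(x))`. -/
def wt (c : Torus) (t : ℝ) (x : Torus) : ℝ≥0∞ := ENNReal.ofReal (absCos (x - c)) ^ (2 * t)

/-- The weight `exp (t ψ^c_n(x))`. -/
def wtProd (c : Torus) (t : ℝ) (n : ℕ) (x : Torus) : ℝ≥0∞ :=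
  ∏ k ∈ Finset.range n, wt c t (dbl^[k] x)

theorem exp_psi (c x : Torus) :
    EReal.exp (psi c x) = ENNReal.ofReal (absCos (x - c)) ^ (2 : ℝ) := by
  unfold psi
  split_ifs with h
  · simp [h]
  · have hpos : 0 < absCos (x - c) := lt_of_le_of_ne (absCos_nonneg _) (Ne.symm h)
    rw [EReal.exp_coe, ENNReal.ofReal_rpow_of_pos hpos, Real.rpow_def_of_pos hpos, mul_comm]

theorem exp_sum {ι : Type*} (s : Finset ι) (f : ι → EReal) :
    EReal.exp (∑ i ∈ s, f i) = ∏ i ∈ s, EReal.exp (f i) := by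
  classical
  induction s using Finset.induction_on with
  | empty => simp
  | insert a s ha ih => rw [Finset.sum_insert ha, Finset.prod_insert ha, EReal.exp_add, ih]

theorem exp_psiSum_rpow (c : Torus) (t : ℝ) (n : ℕ) (x : Torus) :
    EReal.exp (psiSum c n x) ^ t = wtProd c t n x := by
  rw [psiSum, exp_sum, wtProd, ← ENNReal.prod_rpow_of_ne_top]
  · refine Finset.prod_congr rfl fun k _ => ?_
    rw [exp_psi, wt, ← ENNReal.rpow_mul]
  · intro k _
    rw [exp_psi]
    exact ENNReal.rpow_ne_top_of_nonneg (by norm_num) ENNReal.ofReal_ne_top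

theorem iSup_rpow_of_neg {ι : Sort*} (f : ι → ℝ≥0∞) {t : ℝ} (ht : t < 0) :
    (⨆ i, f i) ^ t = ⨅ i, f i ^ t := by
  have h : ∀ y : ℝ≥0∞, y ^ t = (ENNReal.orderIsoRpow (-t) (by linarith) y)⁻¹ := fun y => by
    rw [ENNReal.orderIsoRpow_apply, ← ENNReal.rpow_neg, neg_neg]
  simp only [h, OrderIso.map_iSup, ENNReal.inv_iSup]

theorem eexp_mul_iSup (c : Torus) {t : ℝ} (ht : t < 0) (n : ℕ) {ι : Type*} (S : Set ι)
    (g : ι → Torus) :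
    eexp ((t : EReal) * ⨆ x ∈ S, psiSum c n (g x)) = ⨅ x ∈ S, wtProd c t n (g x) := by
  rw [eexp_eq_exp, mul_comm, EReal.exp_mul]
  have : EReal.exp (⨆ x ∈ S, psiSum c n (g x)) = ⨆ x ∈ S, EReal.exp (psiSum c n (g x)) := by
    simp only [← EReal.expOrderIso_apply, OrderIso.map_iSup]
  simp only [this, iSup_rpow_of_neg _ ht, exp_psiSum_rpow]

theorem rpow_le_rpow_of_nonpos {x y : ℝ≥0∞} (h : x ≤ y) {t : ℝ} (ht : t ≤ 0) :
    y ^ t ≤ x ^ t := by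
  rw [← neg_neg t, ENNReal.rpow_neg _ (-t), ENNReal.rpow_neg _ (-t), ENNReal.inv_le_inv]
  exact ENNReal.rpow_le_rpow h (by linarith)

theorem one_le_wt (c : Torus) {t : ℝ} (ht : t < 0) (x : Torus) : 1 ≤ wt c t x := by
  have h : ENNReal.ofReal (absCos (x - c)) ≤ 1 := by simpa using absCos_le_one (x - c)
  simpa [wt] using rpow_le_rpow_of_nonpos h (by linarith : 2 * t ≤ 0)

theorem one_le_wtProd (c : Torus) {t : ℝ} (ht : t < 0) (n : ℕ) (x : Torus) :
    1 ≤ wtProd c t n x :=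
  Finset.one_le_prod' fun _ _ => one_le_wt c ht _

theorem wtProd_add (c : Torus) (t : ℝ) (n k : ℕ) (x : Torus) :
    wtProd c t (n + k) x = wtProd c t n x * wtProd c t k (dbl^[n] x) := by
  simp only [wtProd, Finset.prod_range_add, ← Function.iterate_add_apply, add_comm]

theorem wtProd_mono (c : Torus) {t : ℝ} (ht : t < 0) (x : Torus) :
    Monotone fun n => wtProd c t n x := by
  intro n m h
  obtain ⟨k, rfl⟩ := Nat.exists_eq_add_of_le h
  simp only [wtProd_add]
  exact le_mul_of_one_le_right' (one_le_wtProd c ht _ _)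

theorem prod_wtProd_le_wtProd_mul (c : Torus) {t : ℝ} (ht : t < 0) {n q : ℕ} (hq : n ≤ q)
    (k : ℕ) (x : Torus) :
    ∏ a ∈ Finset.range k, wtProd c t n (dbl^[a * q] x) ≤ wtProd c t (k * q) x := by
  induction k with
  | zero => simp [wtProd]
  | succ k ih =>
    rw [Finset.prod_range_succ, add_mul, one_mul, wtProd_add]
    exact mul_le_mul' ih (wtProd_mono c ht _ hq)

theorem presZ_eq (c : Torus) {t : ℝ} (ht : t < 0) (n : ℕ) :
    presZ c t n = ∑ ω : Fin n → Bool, ⨅ x ∈ cyl n ω, wtProd c t n x := by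
  refine Finset.sum_congr rfl fun ω _ => ?_
  exact eexp_mul_iSup c ht n (cyl n ω) id

open Classical in
theorem presZRes_eq (c : Torus) (m : ℕ) {t : ℝ} (ht : t < 0) (n : ℕ) :
    presZRes c m t n = ∑ ω : Fin n → Bool,
      if ∃ x ∈ Xcm c m, ∀ i : Fin n, x i = ω i then
        ⨅ x ∈ {x ∈ Xcm c m | ∀ i : Fin n, x i = ω i}, wtProd c t n (toTorus x) else 0 := by
  refine Finset.sum_congr rfl fun ω _ => ?_
  rw [eexp_mul_iSup c ht n _ toTorus]

/-- The real number in `[0, 1]` with binary digit sequence `x`. -/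
def binVal (x : ℕ → Bool) : ℝ := ∑' i : ℕ, (if x i then (1 : ℝ) else 0) / 2 ^ (i + 1)

theorem digit_div_le (b : Bool) (i : ℕ) :
    (if b then (1 : ℝ) else 0) / 2 ^ (i + 1) ≤ 1 / 2 / 2 ^ i := by
  rw [div_div, ← pow_succ']
  gcongr
  split_ifs <;> norm_num

theorem digit_div_nonneg (b : Bool) (i : ℕ) :
    0 ≤ (if b then (1 : ℝ) else 0) / 2 ^ (i + 1) := by
  positivity

theorem summable_digits (x : ℕ → Bool) :
    Summable fun i : ℕ => (if x i then (1 : ℝ) else 0) / 2 ^ (i + 1) :=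
  Summable.of_nonneg_of_le (fun i => digit_div_nonneg (x i) i) (fun i => digit_div_le (x i) i)
    (summable_geometric_two' 1)

theorem binVal_nonneg (x : ℕ → Bool) : 0 ≤ binVal x :=
  tsum_nonneg fun i => digit_div_nonneg (x i) i

theorem binVal_le_one (x : ℕ → Bool) : binVal x ≤ 1 :=
  (Summable.tsum_le_tsum (fun i => digit_div_le (x i) i) (summable_digits x)
    (summable_geometric_two' 1)).trans_eq (tsum_geometric_two' 1)

theorem continuous_binVal : Continuous binVal := by
  refine continuous_tsum (u := fun i : ℕ => (1 : ℝ) / 2 / 2 ^ i) (fun i => ?_)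
    (summable_geometric_two' 1) fun i x => ?_
  · exact (continuous_of_discreteTopology (f := fun b : Bool =>
      (if b then (1 : ℝ) else 0) / 2 ^ (i + 1))).comp (continuous_apply i)
  · rw [Real.norm_of_nonneg (digit_div_nonneg _ _)]
    exact digit_div_le _ _

theorem binVal_eq_wordVal_add (x : ℕ → Bool) (n : ℕ) :
    binVal x = wordVal n (fun i => x i) + binVal (fun i => x (i + n)) / 2 ^ n := by
  rw [binVal, ← (summable_digits x).sum_add_tsum_nat_add n, wordVal, binVal, ← tsum_div_const,
    Finset.sum_range]
  congr 1
  refine tsum_congr fun i => ?_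
  rw [div_div, ← pow_add]
  congr 2
  ring

theorem wordVal_le_binVal (x : ℕ → Bool) (n : ℕ) : wordVal n (fun i => x i) ≤ binVal x := by
  rw [binVal_eq_wordVal_add x n]
  have := binVal_nonneg fun i => x (i + n)
  linarith [show 0 ≤ binVal (fun i => x (i + n)) / 2 ^ n by positivity]

theorem binVal_le_wordVal_add (x : ℕ → Bool) (n : ℕ) :
    binVal x ≤ wordVal n (fun i => x i) + 1 / 2 ^ n := by
  rw [binVal_eq_wordVal_add x n]
  gcongr
  exact binVal_le_one _

theorem toTorus_eq (x : ℕ → Bool) : toTorus x = (binVal x : Torus) := rfl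

theorem continuous_toTorus : Continuous toTorus :=
  (AddCircle.continuous_mk' 1).comp continuous_binVal

theorem dbl_coe (r : ℝ) : dbl (r : Torus) = ((2 * r : ℝ) : Torus) := by
  rw [two_mul]
  rfl

theorem dbl_iterate_coe (k : ℕ) (r : ℝ) :
    dbl^[k] (r : Torus) = ((2 ^ k * r : ℝ) : Torus) := by
  induction k with
  | zero => simp
  | succ k ih => rw [Function.iterate_succ_apply', ih, dbl_coe, pow_succ', mul_assoc]

theorem toTorus_succ (x : ℕ → Bool) : toTorus (fun i => x (i + 1)) = dbl (toTorus x) := by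
  rw [toTorus_eq, toTorus_eq, dbl_coe, binVal_eq_wordVal_add x 1]
  simp only [wordVal, Finset.univ_unique, Finset.sum_singleton, Fin.default_eq_zero,
    Fin.val_zero, zero_add, pow_one]
  have h : ((if x 0 then (1 : ℝ) else 0 : ℝ) : Torus) = 0 := by
    split_ifs
    · exact AddCircle.coe_period 1
    · rfl
  rw [mul_add, mul_div_cancel₀ _ two_ne_zero, mul_div_cancel₀ _ two_ne_zero, AddCircle.coe_add, h,
    zero_add]

theorem toTorus_shift (x : ℕ → Bool) (k : ℕ) :
    toTorus (fun i => x (i + k)) = dbl^[k] (toTorus x) := by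
  induction k with
  | zero => rfl
  | succ k ih =>
    rw [Function.iterate_succ_apply', ← ih, ← toTorus_succ]
    simp only [add_assoc, add_comm 1 k]

theorem toTorus_mem_cyl {n : ℕ} {ω : Fin n → Bool} {x : ℕ → Bool} (h : ∀ i : Fin n, x i = ω i) :
    toTorus x ∈ cyl n ω := by
  obtain rfl : (fun i : Fin n => x i) = ω := funext h
  exact ⟨binVal x, ⟨wordVal_le_binVal x n, binVal_le_wordVal_add x n⟩, rfl⟩

theorem exists_wordVal_eq (s j : ℕ) (hj : j < 2 ^ s) :
    ∃ ω : Fin s → Bool, wordVal s ω = j / 2 ^ s := by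
  induction s generalizing j with
  | zero =>
    refine ⟨Fin.elim0, ?_⟩
    have : j = 0 := by simpa using hj
    simp [wordVal, this]
  | succ s ih =>
    obtain ⟨ω, hω⟩ := ih (j / 2) (by rw [pow_succ] at hj; omega)
    refine ⟨Fin.snoc ω (decide (j % 2 = 1)), ?_⟩
    unfold wordVal at hω ⊢
    rw [Fin.sum_univ_castSucc]
    simp only [Fin.snoc_castSucc, Fin.snoc_last, Fin.val_castSucc, Fin.val_last]
    rw [hω]
    have hdiv : (j : ℝ) = 2 * (j / 2 : ℕ) + (j % 2 : ℕ) := by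
      exact_mod_cast (Nat.div_add_mod j 2).symm
    have hmod : (if decide (j % 2 = 1) = true then (1 : ℝ) else 0) = (j % 2 : ℕ) := by
      rcases Nat.mod_two_eq_zero_or_one j with h | h <;> simp [h]
    rw [hmod, hdiv, pow_succ']
    field_simp

theorem exists_pos_le_absCos_of_mem_Xcm (c : Torus) (m : ℕ) :
    ∃ δ > 0, ∀ x ∈ Xcm c m, ∀ k, δ ≤ absCos (dbl^[k] (toTorus x) - c) := by
  set K : Set (ℕ → Bool) :=
    {x | ∀ b, IsBinExp (breve c) b → ∃ i : Fin (m + 1), x i ≠ b i} with hK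
  have hclosed : IsClosed K := by
    simp only [hK, ofPred_forall, ofPred_exists]
    refine isClosed_iInter fun b => isClosed_iInter fun _ => isClosed_iUnion_of_finite fun i => ?_
    exact (isClosed_discrete {v : Bool | v ≠ b i}).preimage
      (continuous_apply (A := fun _ : ℕ => Bool) (i : ℕ))
  have hshift : ∀ x ∈ Xcm c m, ∀ k, (fun i => x (i + k)) ∈ K := fun x hx k b hb => by
    simpa only [add_comm k] using hx k b hb
  have hcont : Continuous fun x => absCos (toTorus x - c) :=
    continuous_absCos.comp (continuous_toTorus.sub continuous_const)
  rcases K.eq_empty_or_nonempty with he | hne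
  · refine ⟨1, one_pos, fun x hx => ?_⟩
    simpa [he] using hshift x hx 0
  · obtain ⟨z, hz, hmin⟩ := hclosed.isCompact.exists_isMinOn hne hcont.continuousOn
    refine ⟨absCos (toTorus z - c), lt_of_le_of_ne (absCos_nonneg _) fun h => ?_, fun x hx k => ?_⟩
    · obtain ⟨i, hi⟩ := hz z (eq_breve_of_absCos_sub_eq_zero h.symm)
      exact hi rfl
    · rw [← toTorus_shift]
      exact hmin (hshift x hx k)

theorem wt_le_mul_wt (c : Torus) {t : ℝ} (ht : t < 0) {x y : Torus} {a : ℝ}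
    (h : absCos (x - c) ≤ absCos (y - c) * Real.exp a) :
    wt c t y ≤ ENNReal.ofReal (Real.exp (-(2 * t) * a)) * wt c t x := by
  have h' : absCos (x - c) * Real.exp (-a) ≤ absCos (y - c) := by
    rwa [Real.exp_neg, ← div_eq_mul_inv, div_le_iff₀ (Real.exp_pos a)]
  have := rpow_le_rpow_of_nonpos (ENNReal.ofReal_le_ofReal h') (by linarith : 2 * t ≤ 0)
  rw [ENNReal.ofReal_mul (absCos_nonneg _), ENNReal.mul_rpow_of_ne_top ENNReal.ofReal_ne_top
    ENNReal.ofReal_ne_top, ENNReal.ofReal_rpow_of_pos (Real.exp_pos _), ← Real.exp_mul] at this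
  rwa [wt, wt, mul_comm (ENNReal.ofReal _), neg_mul_comm, mul_comm _ (-a)]

theorem sum_two_pow_div_le (n : ℕ) : ∑ k ∈ Finset.range n, (2 : ℝ) ^ k / 2 ^ n ≤ 1 := by
  rw [← Finset.sum_div, div_le_one (by positivity), geom_sum_eq (by norm_num)]
  norm_num

/-- One-sided bounded distortion on the subshift `X^c_m`. -/
theorem exists_wtProd_le_mul (c : Torus) (m : ℕ) {t : ℝ} (ht : t < 0) :
    ∃ C : ℝ, ∀ (n : ℕ) (ω : Fin n → Bool), ∀ x ∈ cyl n ω, ∀ y ∈ Xcm c m,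
      (∀ i : Fin n, y i = ω i) →
        wtProd c t n (toTorus y) ≤ ENNReal.ofReal (Real.exp C) * wtProd c t n x := by
  obtain ⟨δ, hδ, hX⟩ := exists_pos_le_absCos_of_mem_Xcm c m
  refine ⟨-(2 * t) * (Real.pi / δ), ?_⟩
  rintro n ω _ ⟨ξ, hξ, rfl⟩ y hy hyω
  obtain rfl : (fun i : Fin n => y i) = ω := funext hyω
  have hdist : |ξ - binVal y| ≤ 1 / 2 ^ n := by
    rw [abs_le]
    constructor <;>
      linarith [wordVal_le_binVal y n, binVal_le_wordVal_add y n, hξ.1, hξ.2]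
  have hstep : ∀ k ∈ Finset.range n, wt c t (dbl^[k] (toTorus y)) ≤
      ENNReal.ofReal (Real.exp (-(2 * t) * (Real.pi / δ * (2 ^ k / 2 ^ n)))) *
        wt c t (dbl^[k] (ξ : Torus)) := by
    intro k _
    refine wt_le_mul_wt c ht ?_
    have h1 := hX y hy k
    rw [toTorus_eq, dbl_iterate_coe] at h1 ⊢
    rw [dbl_iterate_coe]
    have h2 := absCos_coe_sub_le (2 ^ k * ξ) (2 ^ k * binVal y) c
    rw [← mul_sub, abs_mul, abs_of_pos (by positivity : (0 : ℝ) < 2 ^ k)] at h2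
    set A := absCos (((2 ^ k * binVal y : ℝ) : Torus) - c)
    have h3 : Real.pi * (2 ^ k * |ξ - binVal y|) ≤ A * (Real.pi / δ * (2 ^ k / 2 ^ n)) := calc
      _ ≤ Real.pi * (2 ^ k * (1 / 2 ^ n)) := by gcongr
      _ = δ * (Real.pi / δ * (2 ^ k / 2 ^ n)) := by field_simp
      _ ≤ _ := by
        have := Real.pi_pos
        gcongr
    have h4 := mul_le_mul_of_nonneg_left (Real.add_one_le_exp (Real.pi / δ * (2 ^ k / 2 ^ n)))
      (hδ.le.trans h1)
    linarith
  calc wtProd c t n (toTorus y)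
      ≤ ∏ k ∈ Finset.range n, (ENNReal.ofReal (Real.exp (-(2 * t) * (Real.pi / δ *
          (2 ^ k / 2 ^ n)))) * wt c t (dbl^[k] (ξ : Torus))) := Finset.prod_le_prod' hstep
    _ = ENNReal.ofReal (Real.exp (-(2 * t) * (Real.pi / δ *
          ∑ k ∈ Finset.range n, (2 : ℝ) ^ k / 2 ^ n))) * wtProd c t n ξ := by
      rw [Finset.prod_mul_distrib, ← ENNReal.ofReal_prod_of_nonneg fun _ _ => (Real.exp_pos _).le,
        ← Real.exp_sum, ← Finset.mul_sum, ← Finset.mul_sum]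
      rfl
    _ ≤ _ := by
      gcongr
      · linarith
      · have := Real.pi_pos
        exact mul_le_of_le_one_right (by positivity) (sum_two_pow_div_le n)

theorem exists_presZRes_le_mul_presZ (c : Torus) (m : ℕ) {t : ℝ} (ht : t < 0) :
    ∃ C : ℝ, ∀ n, presZRes c m t n ≤ ENNReal.ofReal (Real.exp C) * presZ c t n := by
  obtain ⟨C, hC⟩ := exists_wtProd_le_mul c m ht
  refine ⟨C, fun n => ?_⟩
  rw [presZRes_eq c m ht, presZ_eq c ht, Finset.mul_sum]
  refine Finset.sum_le_sum fun ω _ => ?_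
  split_ifs with h
  · obtain ⟨y, hy, hyω⟩ := h
    have hpos : ENNReal.ofReal (Real.exp C) ≠ 0 := by simpa using Real.exp_pos C
    simp only [ENNReal.mul_iInf_of_ne hpos ENNReal.ofReal_ne_top]
    exact le_iInf₂ fun x hx => (iInf₂_le y ⟨hy, hyω⟩).trans (hC n ω x hx y hy hyω)
  · exact zero_le

/-- If `2 ^ s > 3 q`, some word of length `s` occurs in no binary expansion of `z` at the
first `q` positions. -/
theorem exists_word_not_mem_expansions (z : Torus) {s q : ℕ} (h : 3 * q < 2 ^ s) :
    ∃ σ : Fin s → Bool, ∀ b, IsBinExp z b → ∀ r < q, ∃ j : Fin s, b (r + j) ≠ σ j := by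
  obtain ⟨a, rfl⟩ := QuotientAddGroup.mk_surjective z
  set F : ℕ → Finset ℕ := fun r =>
    {⌊2 ^ s * Int.fract (2 ^ r * a)⌋₊, ⌊2 ^ s * Int.fract (2 ^ r * a)⌋₊ - 1, 2 ^ s - 1} with hF
  have hcard : ((Finset.range q).biUnion F).card < (Finset.range (2 ^ s)).card := by
    have := Finset.card_biUnion_le_card_mul (Finset.range q) F 3 fun r _ => Finset.card_le_three
    simp only [Finset.card_range] at this ⊢
    omega
  obtain ⟨j, hj, hjF⟩ := Finset.exists_mem_notMem_of_card_lt_card hcard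
  rw [Finset.mem_range] at hj
  obtain ⟨σ, hσ⟩ := exists_wordVal_eq s j hj
  refine ⟨σ, fun b hb r hr => ?_⟩
  by_contra! hcon
  refine hjF (Finset.mem_biUnion.2 ⟨r, Finset.mem_range.2 hr, ?_⟩)
  set y : ℕ → Bool := fun i => b (i + r) with hy
  have hyσ : (fun i : Fin s => y i) = σ := funext fun i => by rw [hy, ← hcon i, add_comm r]
  have h1 := wordVal_le_binVal y s
  have h2 := binVal_le_wordVal_add y s
  rw [hyσ, hσ] at h1 h2
  have hpos : (0 : ℝ) < 2 ^ s := by positivity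
  rw [div_le_iff₀ hpos] at h1
  rw [← add_div, le_div_iff₀ hpos] at h2
  rw [hF]
  simp only [Finset.mem_insert, Finset.mem_singleton]
  rcases (binVal_le_one y).eq_or_lt with hv | hv
  · rw [hv, one_mul] at h2
    have : 2 ^ s ≤ j + 1 := by exact_mod_cast h2
    omega
  · have hfr : Int.fract (2 ^ r * a) = binVal y := by
      rw [← Int.fract_eq_self.2 ⟨binVal_nonneg y, hv⟩, Int.fract_eq_fract]
      have h0 : ((2 ^ r * a : ℝ) : Torus) = (binVal y : Torus) := by
        rw [← toTorus_eq, hy, toTorus_shift, show toTorus b = (a : Torus) from hb, dbl_iterate_coe]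
      rw [← sub_eq_zero, ← AddCircle.coe_sub, AddCircle.coe_eq_zero_iff] at h0
      obtain ⟨k, hk⟩ := h0
      exact ⟨k, by simpa using hk.symm⟩
    rw [hfr, mul_comm]
    have h3 : j ≤ ⌊binVal y * 2 ^ s⌋₊ := Nat.le_floor h1
    have h4 : ⌊binVal y * 2 ^ s⌋₊ ≤ j + 1 := Nat.floor_le_of_le (by exact_mod_cast h2)
    omega

/-- The sequence `W₀ σ W₁ σ ⋯ W_{k-1} σ 0ⁿ σ 0ⁿ σ ⋯`. -/
def interlace {n s k : ℕ} (σ : Fin s → Bool) (W : Fin k → Fin n → Bool) (i : ℕ) : Bool :=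
  if h : i % (n + s) < n then
    if h' : i / (n + s) < k then W ⟨i / (n + s), h'⟩ ⟨i % (n + s), h⟩ else false
  else if h : i % (n + s) - n < s then σ ⟨i % (n + s) - n, h⟩ else false

theorem interlace_add_mul {n s k : ℕ} (σ : Fin s → Bool) (W : Fin k → Fin n → Bool)
    (a : Fin k) (i : Fin n) : interlace σ W (i + a * (n + s)) = W a i := by
  have hi := i.2
  have h1 : ((i : ℕ) + (a : ℕ) * (n + s)) % (n + s) = (i : ℕ) := by
    rw [Nat.add_mul_mod_self_right, Nat.mod_eq_of_lt (by omega)]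
  have h2 : ((i : ℕ) + (a : ℕ) * (n + s)) / (n + s) = (a : ℕ) := by
    rw [Nat.add_mul_div_right _ _ (by omega), Nat.div_eq_of_lt (by omega), zero_add]
  simp [interlace, h1, h2]

theorem interlace_of_mod_eq {n s k : ℕ} (σ : Fin s → Bool) (W : Fin k → Fin n → Bool)
    {i : ℕ} (j : Fin s) (h : i % (n + s) = n + j) : interlace σ W i = σ j := by
  simp [interlace, h]

theorem interlace_mem_Xcm (c : Torus) {n s k m : ℕ} (hs : 0 < s) (hm : 2 * (n + s) ≤ m + 1)
    {σ : Fin s → Bool}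
    (hσ : ∀ b, IsBinExp (breve c) b → ∀ r < n + s, ∃ j : Fin s, b (r + j) ≠ σ j)
    (W : Fin k → Fin n → Bool) : interlace σ W ∈ Xcm c m := by
  intro l b hb
  by_contra! hcon
  obtain ⟨r, hr, hmod⟩ : ∃ r < n + s, (l + r) % (n + s) = n := by
    have hl := Nat.mod_lt l (by omega : 0 < n + s)
    have hdiv := Nat.mod_add_div l (n + s)
    rcases le_or_gt (l % (n + s)) n with h | h
    · refine ⟨n - l % (n + s), by omega, ?_⟩
      rw [show l + (n - l % (n + s)) = n + (n + s) * (l / (n + s)) by omega,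
        Nat.add_mul_mod_self_left, Nat.mod_eq_of_lt (by omega)]
    · refine ⟨n + (n + s) - l % (n + s), by omega, ?_⟩
      rw [show l + (n + (n + s) - l % (n + s)) = n + (n + s) * (l / (n + s) + 1) by
          rw [mul_add, mul_one]; omega,
        Nat.add_mul_mod_self_left, Nat.mod_eq_of_lt (by omega)]
  obtain ⟨j, hj⟩ := hσ b hb r hr
  refine hj ?_
  have hj2 := j.2
  have h1 := hcon ⟨r + j, by omega⟩
  rw [← h1]
  refine interlace_of_mod_eq σ W j ?_
  rw [← add_assoc, Nat.add_mod, hmod, Nat.mod_eq_of_lt (by omega : (j : ℕ) < n + s),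
    Nat.mod_eq_of_lt (by omega)]

theorem presZ_pow_le_presZRes (c : Torus) {t : ℝ} (ht : t < 0) {n s k m N : ℕ}
    (hs0 : 0 < s) (hs : 3 * (n + s) < 2 ^ s) (hm : 2 * (n + s) ≤ m + 1) (hN : k * (n + s) ≤ N) :
    presZ c t n ^ k ≤ presZRes c m t N := by
  classical
  obtain ⟨σ, hσ⟩ := exists_word_not_mem_expansions (breve c) hs
  have hlt : ∀ (a : Fin k) (i : Fin n), (i : ℕ) + a * (n + s) < N := fun a i => by
    have : ((a : ℕ) + 1) * (n + s) ≤ k * (n + s) := Nat.mul_le_mul_right _ a.2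
    have := i.2
    rw [add_mul] at *
    omega
  set Φ : (Fin k → Fin n → Bool) → Fin N → Bool := fun W i => interlace σ W i with hΦ
  have hinj : Function.Injective Φ := fun W W' h => by
    funext a i
    have := congrFun h ⟨_, hlt a i⟩
    simpa only [hΦ, interlace_add_mul] using this
  rw [presZ_eq c ht, presZRes_eq c m ht, Fintype.sum_pow]
  refine le_trans ?_ (Finset.sum_le_sum_of_subset (Finset.subset_univ (Finset.univ.image Φ)))
  rw [Finset.sum_image hinj.injOn]
  refine Finset.sum_le_sum fun W _ => ?_
  rw [if_pos ⟨_, interlace_mem_Xcm c hs0 hm hσ W, fun _ => rfl⟩]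
  refine le_iInf₂ fun y hy => ?_
  calc ∏ a : Fin k, ⨅ x ∈ cyl n (W a), wtProd c t n x
      ≤ ∏ a : Fin k, wtProd c t n (dbl^[a * (n + s)] (toTorus y)) := by
        refine Finset.prod_le_prod' fun a _ => iInf₂_le _ ?_
        rw [← toTorus_shift]
        refine toTorus_mem_cyl fun i => ?_
        rw [← interlace_add_mul σ W a i]
        exact hy.2 ⟨_, hlt a i⟩
    _ = ∏ a ∈ Finset.range k, wtProd c t n (dbl^[a * (n + s)] (toTorus y)) :=
        (Finset.prod_range fun a => wtProd c t n (dbl^[a * (n + s)] (toTorus y))).symm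
    _ ≤ wtProd c t (k * (n + s)) (toTorus y) :=
        prod_wtProd_le_wtProd_mul c ht (Nat.le_add_right n s) k _
    _ ≤ wtProd c t N (toTorus y) := wtProd_mono c ht _ hN

theorem tendsto_natCast_div_div (q : ℕ) :
    Tendsto (fun N : ℕ => (N : ℝ)⁻¹ * ((N / q : ℕ) : ℝ)) atTop (𝓝 (q : ℝ)⁻¹) := by
  have h := (tendsto_nat_floor_mul_div_atTop (R := ℝ) (a := (q : ℝ)⁻¹) (by positivity)).comp
    tendsto_natCast_atTop_atTop
  refine h.congr fun N => ?_
  simp only [Function.comp]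
  rw [inv_mul_eq_div, inv_mul_eq_div, Nat.floor_div_eq_div]

theorem inv_mul_log_presZ_le_liminf (c : Torus) {t : ℝ} (ht : t < 0) {n s m : ℕ}
    (hs0 : 0 < s) (hs : 3 * (n + s) < 2 ^ s) (hm : 2 * (n + s) ≤ m + 1) :
    ((((n + s : ℕ) : ℝ)⁻¹ : ℝ) : EReal) * ENNReal.log (presZ c t n) ≤
      liminf (fun N : ℕ => (((N : ℝ)⁻¹ : ℝ) : EReal) * ENNReal.log (presZRes c m t N)) atTop := by
  have hne : ((((n + s : ℕ) : ℝ)⁻¹ : ℝ) : EReal) ≠ 0 := by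
    rw [Ne, EReal.coe_eq_zero, inv_eq_zero]
    exact_mod_cast (by omega : n + s ≠ 0)
  have hlim := EReal.Tendsto.mul_const (b := ENNReal.log (presZ c t n))
    (EReal.tendsto_coe.2 (tendsto_natCast_div_div (n + s))) (Or.inl hne) (Or.inl hne)
  rw [← hlim.liminf_eq]
  refine liminf_le_liminf (Eventually.of_forall fun N => ?_)
  have hpow := ENNReal.log_monotone
    (presZ_pow_le_presZRes c ht hs0 hs hm (Nat.div_mul_le_self N (n + s)))
  rw [ENNReal.log_pow] at hpow
  rw [EReal.coe_mul, mul_assoc]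
  exact mul_le_mul_of_nonneg_left hpow (EReal.coe_nonneg.2 (by positivity))

theorem exists_log_presZRes_le (c : Torus) (m : ℕ) {t : ℝ} (ht : t < 0) :
    ∃ u : ℕ → EReal, Tendsto u atTop (𝓝 0) ∧ ∀ N : ℕ,
      (((N : ℝ)⁻¹ : ℝ) : EReal) * ENNReal.log (presZRes c m t N) ≤
        u N + (((N : ℝ)⁻¹ : ℝ) : EReal) * ENNReal.log (presZ c t N) := by
  obtain ⟨C, hC⟩ := exists_presZRes_le_mul_presZ c m ht
  refine ⟨fun N => (((N : ℝ)⁻¹ * C : ℝ) : EReal), ?_, fun N => ?_⟩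
  · have := (tendsto_inv_atTop_nhds_zero_nat (𝕜 := ℝ)).mul_const C
    rw [zero_mul] at this
    exact EReal.tendsto_coe.2 this
  · have hN : (0 : EReal) ≤ (((N : ℝ)⁻¹ : ℝ) : EReal) := EReal.coe_nonneg.2 (by positivity)
    have h := ENNReal.log_monotone (hC N)
    rw [ENNReal.log_mul_add, ENNReal.log_ofReal_of_pos (Real.exp_pos C), Real.log_exp] at h
    refine (mul_le_mul_of_nonneg_left h hN).trans_eq ?_
    rw [EReal.left_distrib_of_nonneg_of_ne_top hN (EReal.coe_ne_top _), ← EReal.coe_mul]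

theorem limsup_presZRes_le (c : Torus) (m : ℕ) {t : ℝ} (ht : t < 0) :
    limsup (fun N : ℕ => (((N : ℝ)⁻¹ : ℝ) : EReal) * ENNReal.log (presZRes c m t N)) atTop ≤
      limsup (fun N : ℕ => (((N : ℝ)⁻¹ : ℝ) : EReal) * ENNReal.log (presZ c t N)) atTop := by
  obtain ⟨u, hu, hle⟩ := exists_log_presZRes_le c m ht
  refine (limsup_le_limsup (Eventually.of_forall hle)).trans ?_
  refine (EReal.limsup_add_le (Or.inl ?_) (Or.inl ?_)).trans_eq ?_ <;> simp [hu.limsup_eq]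

theorem liminf_presZRes_le (c : Torus) (m : ℕ) {t : ℝ} (ht : t < 0) :
    liminf (fun N : ℕ => (((N : ℝ)⁻¹ : ℝ) : EReal) * ENNReal.log (presZRes c m t N)) atTop ≤
      liminf (fun N : ℕ => (((N : ℝ)⁻¹ : ℝ) : EReal) * ENNReal.log (presZ c t N)) atTop := by
  obtain ⟨u, hu, hle⟩ := exists_log_presZRes_le c m ht
  refine (liminf_le_liminf (Eventually.of_forall hle)).trans ?_
  refine (EReal.liminf_add_le (Or.inl ?_) (Or.inl ?_)).trans_eq ?_ <;> simp [hu.limsup_eq]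

theorem three_mul_add_log_lt {n : ℕ} (hn : 1 ≤ n) :
    3 * (n + (Nat.log 2 n + 10)) < 2 ^ (Nat.log 2 n + 10) := by
  have h1 := Nat.lt_pow_succ_log_self one_lt_two n
  have h2 := Nat.log_le_self 2 n
  have h3 : 2 ^ (Nat.log 2 n + 10) = 512 * 2 ^ (Nat.log 2 n + 1) := by ring
  omega

theorem tendsto_add_log_div :
    Tendsto (fun n : ℕ => (n : ℝ)⁻¹ * ((n + (Nat.log 2 n + 10) : ℕ) : ℝ)) atTop (𝓝 1) := by
  have hlog : Tendsto (fun n : ℕ => (n : ℝ)⁻¹ * (Nat.log 2 n : ℝ)) atTop (𝓝 0) := by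
    have h := (Real.isLittleO_log_id_atTop.tendsto_div_nhds_zero.comp
      tendsto_natCast_atTop_atTop).const_mul (Real.log 2)⁻¹
    rw [mul_zero] at h
    refine squeeze_zero (fun n => by positivity) (fun n => ?_) h
    have := Real.natLog_le_logb n 2
    rw [Real.logb] at this
    calc (n : ℝ)⁻¹ * (Nat.log 2 n : ℝ) ≤ (n : ℝ)⁻¹ * (Real.log n / Real.log 2) := by
          gcongr
          exact_mod_cast this
      _ = _ := by
          simp only [Function.comp, id]
          ring
  have h1 : Tendsto (fun n : ℕ => 1 + ((n : ℝ)⁻¹ * (Nat.log 2 n : ℝ) + (n : ℝ)⁻¹ * 10)) atTop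
      (𝓝 1) := by
    simpa using tendsto_const_nhds.add
      (hlog.add ((tendsto_inv_atTop_nhds_zero_nat (𝕜 := ℝ)).mul_const 10))
  refine h1.congr' ?_
  filter_upwards [eventually_ge_atTop 1] with n hn
  have : (n : ℝ) ≠ 0 := by positivity
  push_cast
  field_simp

theorem limsup_presZ_le_liminf (c : Torus) {t : ℝ} (ht : t < 0) :
    limsup (fun N : ℕ => (((N : ℝ)⁻¹ : ℝ) : EReal) * ENNReal.log (presZ c t N)) atTop ≤
      liminf (fun m : ℕ => liminf (fun N : ℕ =>
        (((N : ℝ)⁻¹ : ℝ) : EReal) * ENNReal.log (presZRes c m t N)) atTop) atTop := by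
  set L := liminf (fun m : ℕ => liminf (fun N : ℕ =>
        (((N : ℝ)⁻¹ : ℝ) : EReal) * ENNReal.log (presZRes c m t N)) atTop) atTop
  have hL : ∀ n ≥ 1, ((((n + (Nat.log 2 n + 10) : ℕ) : ℝ)⁻¹ : ℝ) : EReal) *
      ENNReal.log (presZ c t n) ≤ L := fun n hn =>
    le_liminf_of_le (h := by
      filter_upwards [eventually_ge_atTop (2 * (n + (Nat.log 2 n + 10)))] with m hm
      exact inv_mul_log_presZ_le_liminf c ht (Nat.succ_pos _) (three_mul_add_log_lt hn)
        (hm.trans (Nat.le_succ m)))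
  have hlim := EReal.Tendsto.mul_const (b := L) (EReal.tendsto_coe.2 tendsto_add_log_div)
    (Or.inl (by simp)) (Or.inl (by simp))
  rw [EReal.coe_one, one_mul] at hlim
  rw [← hlim.limsup_eq]
  refine limsup_le_limsup ?_
  filter_upwards [eventually_ge_atTop 1] with n hn
  refine le_trans (le_of_eq ?_) (mul_le_mul_of_nonneg_left (hL n hn)
    (EReal.coe_nonneg.2 (by positivity)))
  rw [← mul_assoc, ← EReal.coe_mul, mul_assoc, mul_inv_cancel₀, mul_one]
  positivity

/-- for `c ≠ 0` and `t < 0`, the restricted pressures `P̄_top(t ψ^c | X^c_m)`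
converge (in `ℝ ∪ {+∞}`, i.e. in `EReal`) as `m → ∞` to the upper topological pressure,
which moreover coincides with the lower topological pressure; in particular the
unrestricted pressure exists as a limit (possibly `+∞`). -/
theorem stmt2 (c : Torus) (hc : c ≠ 0) (t : ℝ) (ht : t < 0) :
    Tendsto (fun m : ℕ => presResUpper c m t) atTop (𝓝 (presUpper c t)) ∧
      presUpper c t = presLower c t := by
  have hupper : presUpper c t = limsup (fun N : ℕ =>
      (((N : ℝ)⁻¹ : ℝ) : EReal) * ENNReal.log (presZ c t N)) atTop := by
    simp only [presUpper, elog_eq_log]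
  have hlower : presLower c t = liminf (fun N : ℕ =>
      (((N : ℝ)⁻¹ : ℝ) : EReal) * ENNReal.log (presZ c t N)) atTop := by
    simp only [presLower, elog_eq_log]
  have hres : ∀ m, presResUpper c m t = limsup (fun N : ℕ =>
      (((N : ℝ)⁻¹ : ℝ) : EReal) * ENNReal.log (presZRes c m t N)) atTop := fun m => by
    simp only [presResUpper, elog_eq_log]
  have hmain := limsup_presZ_le_liminf c ht
  refine ⟨tendsto_of_le_liminf_of_limsup_le ?_ ?_, le_antisymm ?_ ?_⟩
  · rw [hupper]
    refine hmain.trans (liminf_le_liminf (Eventually.of_forall fun m => ?_))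
    rw [hres]
    exact liminf_le_limsup
  · refine limsup_le_of_le (h := Eventually.of_forall fun m => ?_)
    rw [hres, hupper]
    exact limsup_presZRes_le c m ht
  · rw [hupper, hlower]
    refine hmain.trans ?_
    refine liminf_le_of_le (h := fun b hb => ?_)
    obtain ⟨m, hm⟩ := hb.exists
    exact hm.trans (liminf_presZRes_le c m ht)
  · rw [hupper, hlower]
    exact liminf_le_limsup

end GTM
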